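/- Let A be a Hermitian matrix partitioned into blocks A = [A_{ij}]_{i,j=1}^k with square diagonal blocks A_{ii}, and let p ≥ 1 be a real number. Then the sum of the p-th powers of the absolute values of all eigenvalues of the diagonal blocks is at most the corresponding sum for A: Σ_{i=1}^k Σ_j |λ_j(A_{ii})|^p ≤ Σ_j |λ_j(A)|^p (pinching inequality for the Schatten p-norm, Hermitian case). -/

import Mathlib

open Matrix Finset

theorem convexOn_abs_rpow {p : ℝ} (hp : 1 ≤ p) :
    ConvexOn ℝ Set.univ fun x : ℝ => |x| ^ p := by
  refine ⟨convex_univ, fun x _ y _ a b ha hb hab => ?_⟩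
  have habs : |a • x + b • y| ≤ a • |x| + b • |y| := by
    simpa [abs_mul, abs_of_nonneg ha, abs_of_nonneg hb] using abs_add_le (a • x) (b • y)
  exact (Real.rpow_le_rpow (abs_nonneg _) habs (by linarith)).trans
    ((convexOn_rpow hp).2 (abs_nonneg x) (abs_nonneg y) ha hb hab)

section Unitary

variable {n : Type*} [Fintype n] [DecidableEq n]

theorem Matrix.sum_normSq_row_of_mem_unitaryGroup {Q : Matrix n n ℂ}
    (hQ : Q ∈ unitaryGroup n ℂ) (j : n) : ∑ l, Complex.normSq (Q j l) = 1 := by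
  have h := congrFun (congrFun (mem_unitaryGroup_iff.mp hQ) j) j
  simp only [mul_apply, star_apply, one_apply_eq, RCLike.star_def, Complex.mul_conj] at h
  exact_mod_cast h

theorem Matrix.sum_normSq_col_of_mem_unitaryGroup {Q : Matrix n n ℂ}
    (hQ : Q ∈ unitaryGroup n ℂ) (l : n) : ∑ j, Complex.normSq (Q j l) = 1 := by
  have h := congrFun (congrFun (mem_unitaryGroup_iff'.mp hQ) l) l
  simp only [mul_apply, star_apply, one_apply_eq, RCLike.star_def,
    mul_comm (starRingEnd ℂ _), Complex.mul_conj] at h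
  exact_mod_cast h

theorem Matrix.re_mul_diagonal_mul_conjTranspose_apply_self (Q : Matrix n n ℂ) (d : n → ℝ)
    (j : n) : ((Q * diagonal (fun l => (d l : ℂ)) * Qᴴ) j j).re =
      ∑ l, Complex.normSq (Q j l) * d l := by
  simp only [mul_apply (M := Q * _), mul_diagonal, conjTranspose_apply, Complex.re_sum]
  refine sum_congr rfl fun l _ => ?_
  simp [Complex.normSq_apply]
  ring

/-- The diagonal of a Hermitian matrix in any orthonormal basis is majorized by its spectrum,
expressed through sums of a convex function. -/
theorem Matrix.IsHermitian.sum_convexOn_diag_conj_le {A : Matrix n n ℂ} (hA : A.IsHermitian)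
    {f : ℝ → ℝ} (hf : ConvexOn ℝ Set.univ f) {W : Matrix n n ℂ} (hW : W ∈ unitaryGroup n ℂ) :
    ∑ j, f ((Wᴴ * A * W) j j).re ≤ ∑ j, f (hA.eigenvalues j) := by
  set Q : Matrix n n ℂ := Wᴴ * (hA.eigenvectorUnitary : Matrix n n ℂ) with hQdef
  have hQ : Q ∈ unitaryGroup n ℂ :=
    mul_mem (Unitary.star_mem hW) hA.eigenvectorUnitary.2
  have hconj : Wᴴ * A * W = Q * diagonal (fun l => (hA.eigenvalues l : ℂ)) * Qᴴ := by
    conv_lhs => rw [hA.spectral_theorem, Unitary.conjStarAlgAut_apply]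
    simp only [hQdef, conjTranspose_mul, conjTranspose_conjTranspose, Matrix.mul_assoc]
    rfl
  calc ∑ j, f ((Wᴴ * A * W) j j).re
      = ∑ j, f (∑ l, Complex.normSq (Q j l) * hA.eigenvalues l) := by
        simp only [hconj, re_mul_diagonal_mul_conjTranspose_apply_self]
    _ ≤ ∑ j, ∑ l, Complex.normSq (Q j l) * f (hA.eigenvalues l) :=
        sum_le_sum fun j _ => hf.map_sum_le (fun l _ => Complex.normSq_nonneg _)
          (sum_normSq_row_of_mem_unitaryGroup hQ j) fun _ _ => Set.mem_univ _
    _ = ∑ l, f (hA.eigenvalues l) := by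
        rw [sum_comm]
        simp only [← sum_mul, sum_normSq_col_of_mem_unitaryGroup hQ, one_mul]

end Unitary

section Block

variable {ι : Type*} [Fintype ι] [DecidableEq ι] {m : ι → Type*}
  [∀ i, Fintype (m i)]

theorem Matrix.blockDiagonal'_mem_unitaryGroup [∀ i, DecidableEq (m i)]
    {U : ∀ i, Matrix (m i) (m i) ℂ}
    (hU : ∀ i, U i ∈ unitaryGroup (m i) ℂ) :
    blockDiagonal' U ∈ unitaryGroup (Σ i, m i) ℂ := by
  rw [mem_unitaryGroup_iff, star_eq_conjTranspose, blockDiagonal'_conjTranspose,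
    ← blockDiagonal'_mul, ← blockDiagonal'_one]
  exact congrArg _ (funext fun i => mem_unitaryGroup_iff.mp (hU i))

theorem Matrix.conj_blockDiagonal'_apply (A : Matrix (Σ i, m i) (Σ i, m i) ℂ)
    (U : ∀ i, Matrix (m i) (m i) ℂ) (i : ι) (a b : m i) :
    ((blockDiagonal' U)ᴴ * A * blockDiagonal' U) ⟨i, a⟩ ⟨i, b⟩ =
      ((U i)ᴴ * A.submatrix (Sigma.mk i) (Sigma.mk i) * U i) a b := by
  have hcol : ∀ (g : (Σ i, m i) → ℂ) (c : m i),
      ∑ x, g x * blockDiagonal' U x ⟨i, c⟩ = ∑ y, g ⟨i, y⟩ * U i y c := by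
    intro g c
    rw [Fintype.sum_sigma, Fintype.sum_eq_single i]
    · simp [blockDiagonal'_apply_eq]
    · intro i' hi'
      simp [blockDiagonal'_apply_ne _ _ _ hi']
  have hrow : ∀ (g : (Σ i, m i) → ℂ) (c : m i),
      ∑ x, star (blockDiagonal' U x ⟨i, c⟩) * g x = ∑ y, star (U i y c) * g ⟨i, y⟩ := by
    intro g c
    rw [Fintype.sum_sigma, Fintype.sum_eq_single i]
    · simp [blockDiagonal'_apply_eq]
    · intro i' hi'
      simp [blockDiagonal'_apply_ne _ _ _ hi']
  simp only [mul_apply, conjTranspose_apply, submatrix_apply, hcol, hrow]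

end Block

/-- Pinching inequality for the Schatten `p`-norm, Hermitian case: the sum of the `p`-th
powers of the absolute values of the eigenvalues of the diagonal blocks of a Hermitian
block matrix is at most the corresponding sum for the whole matrix. -/
theorem pinching_schatten {k : ℕ} {m : Fin k → Type*}
    [∀ i, Fintype (m i)] [∀ i, DecidableEq (m i)]
    (A : Matrix (Σ i, m i) (Σ i, m i) ℂ) (hA : A.IsHermitian) (p : ℝ) (hp : 1 ≤ p) :
    ∑ i, ∑ j, |(hA.submatrix (Sigma.mk i)).eigenvalues j| ^ p ≤
      ∑ j, |hA.eigenvalues j| ^ p := by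
  have hB := fun i => hA.submatrix (Sigma.mk (β := m) i)
  have h := hA.sum_convexOn_diag_conj_le (convexOn_abs_rpow hp)
    (blockDiagonal'_mem_unitaryGroup fun i => (hB i).eigenvectorUnitary.2)
  rw [Fintype.sum_sigma] at h
  refine le_of_eq_of_le (sum_congr rfl fun i _ => sum_congr rfl fun j _ => ?_) h
  have hdiag := congrFun (congrFun (hB i).conjStarAlgAut_star_eigenvectorUnitary j) j
  rw [Unitary.conjStarAlgAut_star_apply] at hdiag
  rw [conj_blockDiagonal'_apply, ← star_eq_conjTranspose]
  rw [hdiag]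
  simp
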